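/- Let V₂₅ ⊂ ℝ³ be the set of 25 directions given (up to scaling) by: (1,0,0), (0,1,0), (0,0,1); (0,1,1), (0,1,−1), (1,0,1), (1,0,−1), (1,1,0), (1,−1,0); (1,1,1), (−1,1,1), (1,−1,1), (1,1,−1); and the twelve vectors (1,1,2), (1,−1,2), (−1,1,2), (−1,−1,2), (1,2,1), (1,2,−1), (−1,2,1), (−1,2,−1), (2,1,1), (2,1,−1), (2,−1,1), (2,−1,−1). Then there is no function f : V₂₅ → {1, 2, 3} such that f(u) ≠ f(v) whenever u and v are orthogonal. That is, the orthogonality graph of the completed Yu–Oh set admits no proper three-colouring. -/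

import Mathlib

open Matrix

/-- The 25 directions of the completed Yu–Oh set: the 13 Yu–Oh directions together with,
for every orthogonal pair among them, the unique third direction completing it to an
orthogonal triple. -/
def V25 : Set (Fin 3 → ℝ) :=
  {![1, 0, 0], ![0, 1, 0], ![0, 0, 1],
   ![0, 1, 1], ![0, 1, -1], ![1, 0, 1], ![1, 0, -1], ![1, 1, 0], ![1, -1, 0],
   ![1, 1, 1], ![-1, 1, 1], ![1, -1, 1], ![1, 1, -1],
   ![1, 1, 2], ![1, -1, 2], ![-1, 1, 2], ![-1, -1, 2],
   ![1, 2, 1], ![1, 2, -1], ![-1, 2, 1], ![-1, 2, -1],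
   ![2, 1, 1], ![2, 1, -1], ![2, -1, 1], ![2, -1, -1]}

set_option synthInstance.maxSize 1000 in
/-- The orthogonality graph of the 13 Yu–Oh directions is not three-colourable: `x, y, z` are
the colours of the axes, `a, a', b, b', c, c'` those of the face diagonals orthogonal to them,
and `d, dx, dy, dz` those of the body diagonals. -/
theorem yuOh13_no_three_colouring :
    ∀ x y : Fin 3, x ≠ y → ∀ z, x ≠ z → y ≠ z →
    ∀ a, x ≠ a → ∀ a', x ≠ a' → a ≠ a' →
    ∀ b, y ≠ b → ∀ b', y ≠ b' → b ≠ b' →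
    ∀ c, z ≠ c → ∀ c', z ≠ c' → c ≠ c' →
    (∃ d, a' ≠ d ∧ b' ≠ d ∧ c' ≠ d) → (∃ dx, a' ≠ dx ∧ b ≠ dx ∧ c ≠ dx) →
    (∃ dy, a ≠ dy ∧ b' ≠ dy ∧ c ≠ dy) → (∃ dz, a ≠ dz ∧ b ≠ dz ∧ c' ≠ dz) → False := by
  decide

/-- The orthogonality graph of the completed Yu–Oh set of 25 directions
admits no proper three-colouring: there is no `f : V₂₅ → {1, 2, 3}` with `f u ≠ f v`
whenever `u, v ∈ V₂₅` are orthogonal. -/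
theorem yuOh25_no_three_colouring :
    ¬ ∃ f : (Fin 3 → ℝ) → Fin 3,
      ∀ u ∈ V25, ∀ v ∈ V25, u ⬝ᵥ v = 0 → f u ≠ f v := by
  rintro ⟨f, hf⟩
  refine yuOh13_no_three_colouring (f ![1, 0, 0]) (f ![0, 1, 0]) ?_ (f ![0, 0, 1]) ?_ ?_
    (f ![0, 1, 1]) ?_ (f ![0, 1, -1]) ?_ ?_
    (f ![1, 0, 1]) ?_ (f ![1, 0, -1]) ?_ ?_
    (f ![1, 1, 0]) ?_ (f ![1, -1, 0]) ?_ ?_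
    ⟨f ![1, 1, 1], ?_, ?_, ?_⟩ ⟨f ![-1, 1, 1], ?_, ?_, ?_⟩
    ⟨f ![1, -1, 1], ?_, ?_, ?_⟩ ⟨f ![1, 1, -1], ?_, ?_, ?_⟩
  all_goals
    apply hf
    · simp only [V25, Set.mem_insert_iff, Set.mem_singleton_iff, true_or, or_true]
    · simp only [V25, Set.mem_insert_iff, Set.mem_singleton_iff, true_or, or_true]
    · simp
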